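/- arXiv:1403.0150 — 3 statements merged into one kernel-verified Lean document; each statement's English description precedes it below -/
import Mathlib

section
/- Let F = (F_1, …, F_m) : ℝⁿ → ℝᵐ have each component F_i locally Lipschitz on ℝⁿ and quasiconvex, and assume F_i(x) > 0 for all x ∈ ℝⁿ and all i. Let x^k ∈ ℝⁿ, α_k > 0, e_k ∈ ℝᵐ with all components positive, and z_k ∈ ℝᵐ with all components nonnegative and z_k ≠ 0. Then there exists x^{k+1} ∈ Ω_k := {x ∈ ℝⁿ : F(x) ⪯ F(x^k)} such that 0 ∈ ∂°h_k(x^{k+1}) + N_{Ω_k}(x^{k+1}), where h_k(x) = ⟨F(x), z_k⟩ + (α_k/2)⟨e_k, z_k⟩‖x − x^k‖². In particular, x^{k+1} can be taken to be a global minimizer of h_k over Ω_k, which exists. -/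
open Filter Metric Set
open scoped Topology RealInnerProductSpace Pointwise

/-- The Clarke directional derivative of `f` at `x` in the direction `d`. -/
noncomputable def clarkeDeriv {n : ℕ} (f : EuclideanSpace ℝ (Fin n) → ℝ)
    (x d : EuclideanSpace ℝ (Fin n)) : ℝ :=
  Filter.limsup (fun p : EuclideanSpace ℝ (Fin n) × ℝ => (f (p.1 + p.2 • d) - f p.1) / p.2)
    ((𝓝 x) ×ˢ (𝓝[>] (0 : ℝ)))

/-- The Clarke subdifferential of `f` at `x`. -/
def clarkeSubdiff {n : ℕ} (f : EuclideanSpace ℝ (Fin n) → ℝ) (x : EuclideanSpace ℝ (Fin n)) :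
    Set (EuclideanSpace ℝ (Fin n)) :=
  {w | ∀ d, ⟪w, d⟫ ≤ clarkeDeriv f x d}

/-- The normal cone to `D` at `x`. -/
def normalCone {n : ℕ} (D : Set (EuclideanSpace ℝ (Fin n))) (x : EuclideanSpace ℝ (Fin n)) :
    Set (EuclideanSpace ℝ (Fin n)) :=
  {v | ∀ y ∈ D, ⟪v, y - x⟫ ≤ 0}

/-- `f` is locally Lipschitz on `ℝⁿ`. -/
def LocLipOn {n : ℕ} (f : EuclideanSpace ℝ (Fin n) → ℝ) : Prop :=
  ∀ x, ∃ ε > (0 : ℝ), ∃ L > (0 : ℝ),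
    ∀ z ∈ ball x ε, ∀ y ∈ ball x ε, |f z - f y| ≤ L * ‖z - y‖

/-- `f` is quasiconvex. -/
def QuasiconvexFun {n : ℕ} (f : EuclideanSpace ℝ (Fin n) → ℝ) : Prop :=
  ∀ x y, ∀ t ∈ Set.Icc (0 : ℝ) 1, f (t • x + (1 - t) • y) ≤ max (f x) (f y)

theorem tendsto_add_smul_nhds {n : ℕ} (x d : EuclideanSpace ℝ (Fin n)) :
    Tendsto (fun p : EuclideanSpace ℝ (Fin n) × ℝ => p.1 + p.2 • d)
      ((𝓝 x) ×ˢ (𝓝[>] (0 : ℝ))) (𝓝 x) := by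
  have h : Tendsto (fun p : EuclideanSpace ℝ (Fin n) × ℝ => p.1 + p.2 • d)
      (𝓝 (x, (0 : ℝ))) (𝓝 (x + (0 : ℝ) • d)) := by
    apply Continuous.tendsto (f := fun p : EuclideanSpace ℝ (Fin n) × ℝ => p.1 + p.2 • d)
    fun_prop
  rw [zero_smul, add_zero, nhds_prod_eq] at h
  exact h.mono_left (prod_mono_right _ nhdsWithin_le_nhds)

/-- Difference quotients of a locally Lipschitz function are bounded near a point. -/
theorem LocallyLipschitz.exists_eventually_abs_quotient_le {n : ℕ}
    {f : EuclideanSpace ℝ (Fin n) → ℝ} (hf : LocallyLipschitz f) (x d : EuclideanSpace ℝ (Fin n)) :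
    ∃ C : ℝ, ∀ᶠ p : EuclideanSpace ℝ (Fin n) × ℝ in (𝓝 x) ×ˢ (𝓝[>] (0 : ℝ)),
      |(f (p.1 + p.2 • d) - f p.1) / p.2| ≤ C := by
  obtain ⟨K, s, hs, hK⟩ := hf x
  refine ⟨K * ‖d‖, ?_⟩
  have hfst : Tendsto (fun p : EuclideanSpace ℝ (Fin n) × ℝ => p.1)
      ((𝓝 x) ×ˢ (𝓝[>] (0 : ℝ))) (𝓝 x) := tendsto_fst
  filter_upwards [hfst.eventually hs, (tendsto_add_smul_nhds x d).eventually hs,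
    tendsto_snd.eventually (self_mem_nhdsWithin (s := Ioi (0 : ℝ)))] with p h1 h2 h3
  have h3 : 0 < p.2 := h3
  have h := hK.dist_le_mul _ h2 _ h1
  rw [Real.dist_eq, dist_eq_norm, add_sub_cancel_left, norm_smul, Real.norm_of_nonneg h3.le] at h
  rw [abs_div, abs_of_pos h3, div_le_iff₀ h3]
  linarith

theorem LocallyLipschitz.clarkeDeriv_le {n : ℕ}
    {f : EuclideanSpace ℝ (Fin n) → ℝ} (hf : LocallyLipschitz f) {x d : EuclideanSpace ℝ (Fin n)}
    {c : ℝ} (h : ∀ᶠ p : EuclideanSpace ℝ (Fin n) × ℝ in (𝓝 x) ×ˢ (𝓝[>] (0 : ℝ)),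
      (f (p.1 + p.2 • d) - f p.1) / p.2 ≤ c) : clarkeDeriv f x d ≤ c := by
  obtain ⟨C, hC⟩ := hf.exists_eventually_abs_quotient_le x d
  refine limsup_le_of_le (IsBoundedUnder.isCoboundedUnder_le ⟨-C, ?_⟩) h
  rw [eventually_map]
  exact hC.mono fun p hp => (abs_le.1 hp).1

theorem LocallyLipschitz.eventually_quotient_lt {n : ℕ}
    {f : EuclideanSpace ℝ (Fin n) → ℝ} (hf : LocallyLipschitz f) {x d : EuclideanSpace ℝ (Fin n)}
    {c : ℝ} (h : clarkeDeriv f x d < c) :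
    ∀ᶠ p : EuclideanSpace ℝ (Fin n) × ℝ in (𝓝 x) ×ˢ (𝓝[>] (0 : ℝ)),
      (f (p.1 + p.2 • d) - f p.1) / p.2 < c := by
  obtain ⟨C, hC⟩ := hf.exists_eventually_abs_quotient_le x d
  refine eventually_lt_of_limsup_lt h ⟨C, ?_⟩
  rw [eventually_map]
  exact hC.mono fun p hp => (abs_le.1 hp).2

theorem LocallyLipschitz.clarkeDeriv_add_le {n : ℕ}
    {f : EuclideanSpace ℝ (Fin n) → ℝ} (hf : LocallyLipschitz f)
    (x d d' : EuclideanSpace ℝ (Fin n)) :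
    clarkeDeriv f x (d + d') ≤ clarkeDeriv f x d + clarkeDeriv f x d' := by
  refine le_of_forall_pos_le_add fun ε hε => hf.clarkeDeriv_le ?_
  have h1 := hf.eventually_quotient_lt (lt_add_of_pos_right (clarkeDeriv f x d) (half_pos hε))
  have h2 := ((tendsto_add_smul_nhds x d).prodMk
    (tendsto_snd (f := 𝓝 x) (g := 𝓝[>] (0 : ℝ)))).eventually
    (hf.eventually_quotient_lt (lt_add_of_pos_right (clarkeDeriv f x d') (half_pos hε)))
  filter_upwards [h1, h2] with p h1 h2
  have : (f (p.1 + p.2 • (d + d')) - f p.1) / p.2 =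
      (f (p.1 + p.2 • d) - f p.1) / p.2 +
        (f (p.1 + p.2 • d + p.2 • d') - f (p.1 + p.2 • d)) / p.2 := by
    rw [smul_add, ← add_assoc]; ring
  linarith

theorem LocallyLipschitz.clarkeDeriv_smul_le {n : ℕ}
    {f : EuclideanSpace ℝ (Fin n) → ℝ} (hf : LocallyLipschitz f)
    (x d : EuclideanSpace ℝ (Fin n)) {c : ℝ} (hc : 0 < c) :
    clarkeDeriv f x (c • d) ≤ c * clarkeDeriv f x d := by
  refine le_of_forall_pos_le_add fun ε hε => hf.clarkeDeriv_le ?_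
  have hscale : Tendsto (fun t : ℝ => t * c) (𝓝[>] 0) (𝓝[>] 0) := by
    refine tendsto_nhdsWithin_iff.2 ⟨?_, ?_⟩
    · have : Tendsto (fun t : ℝ => t * c) (𝓝 0) (𝓝 (0 * c)) := tendsto_id.mul_const c
      rw [zero_mul] at this
      exact this.mono_left nhdsWithin_le_nhds
    · exact eventually_mem_nhdsWithin.mono fun t ht => mul_pos ht hc
  have h := ((tendsto_id (x := 𝓝 x)).prodMap hscale).eventually
    (hf.eventually_quotient_lt (lt_add_of_pos_right (clarkeDeriv f x d) (div_pos hε hc)))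
  filter_upwards [h] with p hp
  simp only [Prod.map, id] at hp
  have key : (f (p.1 + p.2 • c • d) - f p.1) / p.2 =
      c * ((f (p.1 + (p.2 * c) • d) - f p.1) / (p.2 * c)) := by
    rw [smul_smul]
    field_simp
  have := mul_le_mul_of_nonneg_left hp.le hc.le
  rw [mul_add, mul_div_cancel₀ _ hc.ne'] at this
  linarith

theorem LocallyLipschitz.clarkeDeriv_smul {n : ℕ}
    {f : EuclideanSpace ℝ (Fin n) → ℝ} (hf : LocallyLipschitz f)
    (x d : EuclideanSpace ℝ (Fin n)) {c : ℝ} (hc : 0 < c) :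
    clarkeDeriv f x (c • d) = c * clarkeDeriv f x d := by
  refine le_antisymm (hf.clarkeDeriv_smul_le x d hc) ?_
  have h := hf.clarkeDeriv_smul_le x (c • d) (inv_pos.2 hc)
  rwa [inv_smul_smul₀ hc.ne', ← div_eq_inv_mul, le_div_iff₀' hc] at h

/-- At a minimizer over a convex set, the Clarke derivative is nonnegative in every
feasible direction. -/
theorem IsMinOn.clarkeDeriv_nonneg {n : ℕ} {f : EuclideanSpace ℝ (Fin n) → ℝ}
    {D : Set (EuclideanSpace ℝ (Fin n))} {x y : EuclideanSpace ℝ (Fin n)}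
    (hmin : IsMinOn f D x) (hf : LocallyLipschitz f) (hD : Convex ℝ D) (hx : x ∈ D)
    (hy : y ∈ D) : 0 ≤ clarkeDeriv f x (y - x) := by
  by_contra! hneg
  have hpair : Tendsto (fun t : ℝ => (x, t)) (𝓝[>] 0) (𝓝 x ×ˢ 𝓝[>] 0) :=
    tendsto_const_nhds.prodMk tendsto_id
  obtain ⟨t, ht, ht0, ht1⟩ := ((hpair.eventually (hf.eventually_quotient_lt hneg)).and
    (Ioc_mem_nhdsGT one_pos)).exists
  have hmem := hD.add_smul_sub_mem hx hy ⟨ht0.le, ht1⟩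
  exact ht.not_ge (div_nonneg (sub_nonneg.2 (hmin hmem)) ht0.le)

/-- A sublinear functional which is nonnegative on a convex cone `K` dominates a linear
functional which is nonnegative on `K`. -/
theorem ConvexCone.exists_linearMap_le_sublinear {V : Type*} [AddCommGroup V] [Module ℝ V]
    (K : ConvexCone ℝ V) (hK : K.Pointed) (g : V → ℝ)
    (g_hom : ∀ c : ℝ, 0 < c → ∀ x, g (c • x) = c * g x)
    (g_add : ∀ x y, g (x + y) ≤ g x + g y) (g_nonneg : ∀ k ∈ K, 0 ≤ g k) :
    ∃ w : V →ₗ[ℝ] ℝ, (∀ x, w x ≤ g x) ∧ ∀ k ∈ K, 0 ≤ w k := by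
  set p : V → ℝ := fun d => ⨅ k : K, g (d + k)
  have : Nonempty K := ⟨⟨0, hK⟩⟩
  have hbdd (d : V) : BddBelow (range fun k : K => g (d + k)) := by
    refine ⟨-g (-d), ?_⟩
    rintro _ ⟨k, rfl⟩
    have h := g_add (-d) (d + k)
    rw [neg_add_cancel_left] at h
    have := g_nonneg k k.2
    simp only
    linarith
  have p_le (d k : V) (hk : k ∈ K) : p d ≤ g (d + k) := ciInf_le (hbdd d) ⟨k, hk⟩
  have p_hom_le (c : ℝ) (hc : 0 < c) (d : V) : p (c • d) ≤ c * p d := by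
    rw [← div_le_iff₀' hc]
    refine le_ciInf fun k => ?_
    rw [div_le_iff₀' hc, ← g_hom c hc, smul_add]
    exact p_le _ _ (K.smul_mem hc k.2)
  have p_hom (c : ℝ) (hc : 0 < c) (d : V) : p (c • d) = c * p d := by
    refine le_antisymm (p_hom_le c hc d) ?_
    have h := p_hom_le c⁻¹ (inv_pos.2 hc) (c • d)
    rwa [inv_smul_smul₀ hc.ne', ← div_eq_inv_mul, le_div_iff₀' hc] at h
  have p_add (d d' : V) : p (d + d') ≤ p d + p d' := by
    refine le_ciInf_add_ciInf fun k k' => ?_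
    refine (p_le _ _ (K.add_mem k.2 k'.2)).trans ?_
    rw [add_add_add_comm]
    exact g_add _ _
  have p_zero : 0 ≤ p 0 := le_ciInf fun k => by simpa using g_nonneg k k.2
  obtain ⟨w, -, hw⟩ := exists_extension_of_le_sublinear ⟨⊥, 0⟩ p p_hom p_add (by
    rintro ⟨x, hx⟩
    obtain rfl := (Submodule.mem_bot ℝ).1 hx
    simpa using p_zero)
  have g_zero : g 0 = 0 := by
    have := g_hom 2 two_pos 0
    rw [smul_zero] at this
    linarith
  refine ⟨w, fun x => (hw x).trans (by simpa using p_le x 0 hK), fun k hk => ?_⟩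
  have h := (hw (-k)).trans (p_le _ k hk)
  rw [neg_add_cancel, g_zero, map_neg] at h
  linarith

/-- First-order optimality condition for the minimization of a locally Lipschitz function over a
convex set. -/
theorem IsMinOn.zero_mem_clarkeSubdiff_add_normalCone {n : ℕ} {f : EuclideanSpace ℝ (Fin n) → ℝ}
    {D : Set (EuclideanSpace ℝ (Fin n))} {x : EuclideanSpace ℝ (Fin n)}
    (hmin : IsMinOn f D x) (hf : LocallyLipschitz f) (hD : Convex ℝ D) (hx : x ∈ D) :
    (0 : EuclideanSpace ℝ (Fin n)) ∈ clarkeSubdiff f x + normalCone D x := by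
  have hD' : Convex ℝ ((fun y => -x + y) '' D) := hD.translate (-x)
  have h0 : (0 : EuclideanSpace ℝ (Fin n)) ∈ (fun y => -x + y) '' D := ⟨x, hx, neg_add_cancel x⟩
  obtain ⟨w, hw, hwD⟩ := (ConvexCone.hull ℝ _).exists_linearMap_le_sublinear
    (ConvexCone.subset_hull h0) (clarkeDeriv f x)
    (fun c hc d => hf.clarkeDeriv_smul x d hc) (hf.clarkeDeriv_add_le x) (by
      intro k hk
      obtain ⟨c, hc, _, ⟨y, hy, rfl⟩, rfl⟩ := (ConvexCone.mem_hull_of_convex hD').1 hk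
      simp only [neg_add_eq_sub]
      rw [hf.clarkeDeriv_smul x _ hc]
      exact mul_nonneg hc.le (hmin.clarkeDeriv_nonneg hf hD hx hy))
  set v := (InnerProductSpace.toDual ℝ (EuclideanSpace ℝ (Fin n))).symm w.toContinuousLinearMap
  have hv (d : EuclideanSpace ℝ (Fin n)) : ⟪v, d⟫ = w d := by simp [v]
  refine ⟨v, fun d => (hv d).trans_le (hw d), -v, fun y hy => ?_, add_neg_cancel v⟩
  rw [inner_neg_left, hv, neg_nonpos]
  exact hwD _ (ConvexCone.subset_hull ⟨y, hy, neg_add_eq_sub x y⟩)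

theorem LocLipOn.locallyLipschitz {n : ℕ} {f : EuclideanSpace ℝ (Fin n) → ℝ} (hf : LocLipOn f) :
    LocallyLipschitz f := by
  intro x
  obtain ⟨ε, hε, L, hL, h⟩ := hf x
  refine ⟨⟨L, hL.le⟩, ball x ε, ball_mem_nhds x hε, LipschitzOnWith.of_dist_le_mul ?_⟩
  intro z hz y hy
  rw [Real.dist_eq, dist_eq_norm]
  exact h z hz y hy

theorem LocallyLipschitz.finsetSum {X ι : Type*} [PseudoEMetricSpace X] {f : ι → X → ℝ}
    (s : Finset ι) (hf : ∀ i ∈ s, LocallyLipschitz (f i)) :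
    LocallyLipschitz fun x => ∑ i ∈ s, f i x := by
  classical
  induction s using Finset.induction_on with
  | empty => simpa using LocallyLipschitz.const (0 : ℝ)
  | insert a s ha ih =>
    simp_rw [Finset.sum_insert ha]
    exact (hf a (Finset.mem_insert_self a s)).add
      (ih fun i hi => hf i (Finset.mem_insert_of_mem hi))

theorem QuasiconvexFun.convex_sublevel {n : ℕ} {f : EuclideanSpace ℝ (Fin n) → ℝ}
    (hf : QuasiconvexFun f) (c : ℝ) : Convex ℝ {x | f x ≤ c} := by
  intro x hx y hy a b ha hb hab
  obtain rfl : b = 1 - a := by linarith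
  exact (hf x y a ⟨ha, by linarith⟩).trans (max_le hx hy)

/-- Existence of the SPPM iterate: there is a global minimizer `x⁺` of
`h_k(x) = ⟨F(x), z_k⟩ + (α_k/2)⟨e_k, z_k⟩‖x − x^k‖²` over
`Ω_k = {x : F(x) ⪯ F(x^k)}`, and it satisfies `0 ∈ ∂°h_k(x⁺) + N_{Ω_k}(x⁺)`. -/
theorem sppm_iterate_exists {n m : ℕ} (F : Fin m → EuclideanSpace ℝ (Fin n) → ℝ)
    (hlip : ∀ i, LocLipOn (F i)) (hquasi : ∀ i, QuasiconvexFun (F i))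
    (hpos : ∀ x i, 0 < F i x)
    (xk : EuclideanSpace ℝ (Fin n)) (αk : ℝ) (hα : 0 < αk)
    (ek zk : EuclideanSpace ℝ (Fin m))
    (he : ∀ i, 0 < ek i) (hz : ∀ i, 0 ≤ zk i) (hz0 : zk ≠ 0) :
    ∃ x1 ∈ {x : EuclideanSpace ℝ (Fin n) | ∀ i, F i x ≤ F i xk},
      (∀ x ∈ {x : EuclideanSpace ℝ (Fin n) | ∀ i, F i x ≤ F i xk},
        (∑ i, zk i * F i x1) + αk / 2 * (∑ i, ek i * zk i) * ‖x1 - xk‖ ^ 2 ≤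
          (∑ i, zk i * F i x) + αk / 2 * (∑ i, ek i * zk i) * ‖x - xk‖ ^ 2) ∧
      (0 : EuclideanSpace ℝ (Fin n)) ∈
        clarkeSubdiff
          (fun x => (∑ i, zk i * F i x) + αk / 2 * (∑ i, ek i * zk i) * ‖x - xk‖ ^ 2) x1 +
        normalCone {x : EuclideanSpace ℝ (Fin n) | ∀ i, F i x ≤ F i xk} x1 := by
  set Ω := {x : EuclideanSpace ℝ (Fin n) | ∀ i, F i x ≤ F i xk}
  set c := αk / 2 * ∑ i, ek i * zk i
  set h : EuclideanSpace ℝ (Fin n) → ℝ := fun x => (∑ i, zk i * F i x) + c * ‖x - xk‖ ^ 2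
  have hc : 0 < c := by
    obtain ⟨j, hj⟩ : ∃ j, zk j ≠ 0 := by
      by_contra! hzero
      exact hz0 (PiLp.ext hzero)
    refine mul_pos (half_pos hα) (Finset.sum_pos' (fun i _ => mul_nonneg (he i).le (hz i))
      ⟨j, Finset.mem_univ j, mul_pos (he j) ((hz j).lt_of_ne' hj)⟩)
  have hF (i : Fin m) : LocallyLipschitz (F i) := (hlip i).locallyLipschitz
  have hh : LocallyLipschitz h := by
    refine (LocallyLipschitz.finsetSum _ fun i _ => ?_).add ?_
    · exact (lipschitzWith_smul (zk i)).locallyLipschitz.comp (hF i)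
    · refine ContDiff.locallyLipschitz (𝕂 := ℝ) ?_
      exact contDiff_const.mul ((contDiff_id.sub contDiff_const).norm_sq ℝ)
  have hΩ : Ω = ⋂ i, {x | F i x ≤ F i xk} := ofPred_forall _
  have hΩconvex : Convex ℝ Ω := hΩ ▸ convex_iInter fun i => (hquasi i).convex_sublevel _
  have hΩclosed : IsClosed Ω :=
    hΩ ▸ isClosed_iInter fun i => isClosed_le (hF i).continuous continuous_const
  have hcoercive : ∀ᶠ x in cocompact (EuclideanSpace ℝ (Fin n)) ⊓ 𝓟 Ω, h xk ≤ h x := by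
    refine Eventually.filter_mono inf_le_left ?_
    filter_upwards [(tendsto_dist_right_cocompact_atTop xk).eventually_ge_atTop
      (max 1 (h xk / c))] with x hx
    rw [dist_eq_norm] at hx
    have h1 : 1 ≤ ‖x - xk‖ := (le_max_left _ _).trans hx
    have h2 : h xk ≤ ‖x - xk‖ * c := (div_le_iff₀ hc).1 ((le_max_right _ _).trans hx)
    have h3 : 0 ≤ ∑ i, zk i * F i x :=
      Finset.sum_nonneg fun i _ => mul_nonneg (hz i) (hpos x i).le
    have h4 : c * ‖x - xk‖ ≤ c * ‖x - xk‖ ^ 2 :=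
      mul_le_mul_of_nonneg_left (le_self_pow₀ h1 two_ne_zero) hc.le
    change h xk ≤ (∑ i, zk i * F i x) + c * ‖x - xk‖ ^ 2
    linarith
  obtain ⟨x1, hx1, hmin⟩ := hh.continuous.continuousOn.exists_isMinOn' hΩclosed
    (show xk ∈ Ω from fun _ => le_rfl) hcoercive
  exact ⟨x1, hx1, fun x hx => hmin hx,
    hmin.zero_mem_clarkeSubdiff_add_normalCone hh hΩconvex hx1⟩
end

section
/- Let F = (F_1, …, F_m) : ℝⁿ → ℝᵐ have each component F_i locally Lipschitz on ℝⁿ, quasiconvex and positive, and let {x^k} be an SPPM sequence that is Fejér convergent to the nonempty set E = {x ∈ ℝⁿ : F(x) ⪯ F(x^k) for all k}. Then {x^k} converges to some point of E. -/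
open Filter Metric Set
open scoped Topology RealInnerProductSpace Pointwise

/-- An SPPM sequence for `F` with parameters `α`, `e`, `z`: for every `k`,
`x^{k+1} ∈ Ω_k = {x : F(x) ⪯ F(x^k)}` and `0 ∈ ∂°h_k(x^{k+1}) + N_{Ω_k}(x^{k+1})`,
where `h_k(x) = ⟨F(x), z_k⟩ + (α_k/2)⟨e_k, z_k⟩‖x − x^k‖²`. -/
def SPPMSeq {n m : ℕ} (F : Fin m → EuclideanSpace ℝ (Fin n) → ℝ)
    (x : ℕ → EuclideanSpace ℝ (Fin n)) (α : ℕ → ℝ)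
    (e z : ℕ → EuclideanSpace ℝ (Fin m)) : Prop :=
  (∀ k, 0 < α k) ∧ (∀ k i, 0 < e k i) ∧ (∀ k i, 0 ≤ z k i) ∧ (∀ k, z k ≠ 0) ∧
  (∀ k, (∀ i, F i (x (k + 1)) ≤ F i (x k)) ∧
    (0 : EuclideanSpace ℝ (Fin n)) ∈
      clarkeSubdiff
        (fun y => (∑ i, z k i * F i y) + α k / 2 * (∑ i, e k i * z k i) * ‖y - x k‖ ^ 2)
        (x (k + 1)) +
      normalCone {y : EuclideanSpace ℝ (Fin n) | ∀ i, F i y ≤ F i (x k)} (x (k + 1)))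


/-- A locally Lipschitz function is continuous. -/
theorem LocLipOn.continuous {n : ℕ} {f : EuclideanSpace ℝ (Fin n) → ℝ} (hf : LocLipOn f) :
    Continuous f := by
  refine continuous_iff_continuousAt.2 fun x => ?_
  obtain ⟨ε, hε, L, hL, h⟩ := hf x
  have hlip : LipschitzOnWith L.toNNReal f (ball x ε) := by
    refine LipschitzOnWith.of_dist_le_mul fun z hz y hy => ?_
    rw [Real.dist_eq, dist_eq_norm, Real.coe_toNNReal L hL.le]
    exact h z hz y hy
  exact hlip.continuousOn.continuousAt (ball_mem_nhds x hε)

/-- If an SPPM sequence (for `F` with positive, quasiconvex, locally Lipschitz components)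
is Fejér convergent to the nonempty set `E = {x : F(x) ⪯ F(x^k) ∀ k}`, then it converges
to some point of `E`. -/
theorem sppm_converges_to_E {n m : ℕ} (F : Fin m → EuclideanSpace ℝ (Fin n) → ℝ)
    (hlip : ∀ i, LocLipOn (F i)) (hquasi : ∀ i, QuasiconvexFun (F i))
    (hpos : ∀ x i, 0 < F i x)
    (x : ℕ → EuclideanSpace ℝ (Fin n)) (α : ℕ → ℝ) (e z : ℕ → EuclideanSpace ℝ (Fin m))
    (hsppm : SPPMSeq F x α e z)
    (hEne : ({y : EuclideanSpace ℝ (Fin n) | ∀ k, ∀ i, F i y ≤ F i (x k)}).Nonempty)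
    (hfejer : ∀ u ∈ {y : EuclideanSpace ℝ (Fin n) | ∀ k, ∀ i, F i y ≤ F i (x k)},
      ∀ k : ℕ, ‖x (k + 1) - u‖ ≤ ‖x k - u‖) :
    ∃ xbar ∈ {y : EuclideanSpace ℝ (Fin n) | ∀ k, ∀ i, F i y ≤ F i (x k)},
      Tendsto x atTop (𝓝 xbar) := by
  obtain ⟨u, hu⟩ := hEne
  have hdist_anti : ∀ v ∈ {y : EuclideanSpace ℝ (Fin n) | ∀ k, ∀ i, F i y ≤ F i (x k)},
      Antitone fun k => ‖x k - v‖ := fun v hv => antitone_nat_of_succ_le (hfejer v hv)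
  have hmem : ∀ k, x k ∈ closedBall u ‖x 0 - u‖ := fun k => by
    rw [mem_closedBall, dist_eq_norm]
    exact hdist_anti u hu (Nat.zero_le k)
  obtain ⟨xbar, -, φ, hφ, hlim⟩ := tendsto_subseq_of_bounded isBounded_closedBall hmem
  have hxbar : xbar ∈ {y : EuclideanSpace ℝ (Fin n) | ∀ k, ∀ i, F i y ≤ F i (x k)} := by
    intro k i
    have hanti : Antitone fun j => F i (x j) :=
      antitone_nat_of_succ_le fun j => (hsppm.2.2.2.2 j).1 i
    refine le_of_tendsto (((hlip i).continuous.tendsto xbar).comp hlim) ?_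
    filter_upwards [eventually_ge_atTop k] with j hj
    exact hanti (hj.trans (hφ.id_le j))
  refine ⟨xbar, hxbar, tendsto_iff_norm_sub_tendsto_zero.2 ?_⟩
  exact (tendsto_iff_tendsto_subseq_of_antitone (hdist_anti xbar hxbar) hφ.tendsto_atTop).2
    (tendsto_iff_norm_sub_tendsto_zero.1 hlim)
end

section
/- Let F = (F_1, …, F_m) : ℝⁿ → ℝᵐ have each component F_i locally Lipschitz on ℝⁿ, quasiconvex and positive, satisfying the completeness assumption (H3) relative to the initial point x⁰. Let {x^k} be an SPPM sequence with 0 < α_k < ᾱ for some ᾱ > 0, ‖e_k‖ = 1, ‖z_k‖ = 1, such that for every k the interior of Ω_{k+1} is nonempty with F(x) ≺ F(x^{k+1}) for every x in that interior. Then {x^k} converges to a Pareto-Clarke critical point of the problem min{F(x) : x ∈ ℝⁿ}. -/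
open Filter Metric Set
open scoped Topology RealInnerProductSpace Pointwise

/-- The completeness assumption (H3) relative to the initial point `x0`. -/
def H3 {n m : ℕ} (F : Fin m → EuclideanSpace ℝ (Fin n) → ℝ)
    (x0 : EuclideanSpace ℝ (Fin n)) : Prop :=
  ∀ a : ℕ → EuclideanSpace ℝ (Fin n), a 0 = x0 →
    (∀ k, ∀ i, F i (a (k + 1)) ≤ F i (a k)) →
    ∃ b : EuclideanSpace ℝ (Fin n), ∀ k, ∀ i, F i b ≤ F i (a k)

theorem tendsto_add_smul_nhds_prod {n : ℕ} (x d : EuclideanSpace ℝ (Fin n)) :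
    Tendsto (fun p : EuclideanSpace ℝ (Fin n) × ℝ => p.1 + p.2 • d)
      (𝓝 x ×ˢ 𝓝[>] (0 : ℝ)) (𝓝 x) := by
  have hc : Continuous fun p : EuclideanSpace ℝ (Fin n) × ℝ => p.1 + p.2 • d := by fun_prop
  have h := hc.tendsto (x, (0 : ℝ))
  rw [nhds_prod_eq] at h
  simp only [zero_smul, add_zero] at h
  exact h.mono_left (Filter.prod_mono le_rfl nhdsWithin_le_nhds)

theorem eventually_snd_pos {n : ℕ} (x : EuclideanSpace ℝ (Fin n)) :
    ∀ᶠ p : EuclideanSpace ℝ (Fin n) × ℝ in 𝓝 x ×ˢ 𝓝[>] (0 : ℝ), 0 < p.2 :=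
  tendsto_snd.eventually (eventually_mem_nhdsWithin (a := (0 : ℝ)) (s := Ioi 0))

/-- Difference quotients of a locally Lipschitz function are locally bounded. -/
theorem LocLipOn.eventually_abs_quotient_le {n : ℕ} {f : EuclideanSpace ℝ (Fin n) → ℝ}
    (hf : LocLipOn f) (x d : EuclideanSpace ℝ (Fin n)) :
    ∃ C : ℝ, ∀ᶠ p : EuclideanSpace ℝ (Fin n) × ℝ in 𝓝 x ×ˢ 𝓝[>] (0 : ℝ),
      |(f (p.1 + p.2 • d) - f p.1) / p.2| ≤ C := by
  obtain ⟨ε, hε, L, hL, h⟩ := hf x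
  refine ⟨L * ‖d‖, ?_⟩
  filter_upwards [(tendsto_add_smul_nhds_prod x d).eventually (ball_mem_nhds x hε),
    tendsto_fst.eventually (ball_mem_nhds x hε), eventually_snd_pos x] with p h1 h2 h3
  have h4 := h _ h1 _ h2
  rw [add_sub_cancel_left, norm_smul, Real.norm_of_nonneg h3.le] at h4
  rw [abs_div, abs_of_pos h3, div_le_iff₀ h3]
  linarith

theorem LocLipOn.eventually_sub_le {n : ℕ} {f : EuclideanSpace ℝ (Fin n) → ℝ}
    (hf : LocLipOn f) {x d : EuclideanSpace ℝ (Fin n)} {s : ℝ} (hs : clarkeDeriv f x d < -s) :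
    ∀ᶠ p : EuclideanSpace ℝ (Fin n) × ℝ in 𝓝 x ×ˢ 𝓝[>] (0 : ℝ),
      f (p.1 + p.2 • d) - f p.1 ≤ -s * p.2 := by
  obtain ⟨C, hC⟩ := hf.eventually_abs_quotient_le x d
  have hb : IsBoundedUnder (· ≤ ·) (𝓝 x ×ˢ 𝓝[>] (0 : ℝ))
      (fun p : EuclideanSpace ℝ (Fin n) × ℝ => (f (p.1 + p.2 • d) - f p.1) / p.2) :=
    isBoundedUnder_of_eventually_le (hC.mono fun p hp => (abs_le.1 hp).2)
  filter_upwards [eventually_lt_of_limsup_lt hs hb, eventually_snd_pos x] with p h1 h2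
  exact ((div_lt_iff₀ h2).1 h1).le

/-- A quasiconvex function does not increase in directions towards a point of lower value. -/
theorem QuasiconvexFun.eventually_sub_nonpos {n : ℕ} {f : EuclideanSpace ℝ (Fin n) → ℝ}
    (hq : QuasiconvexFun f) (hf : Continuous f) {x y : EuclideanSpace ℝ (Fin n)}
    (hxy : f y < f x) :
    ∀ᶠ p : EuclideanSpace ℝ (Fin n) × ℝ in 𝓝 x ×ˢ 𝓝[>] (0 : ℝ),
      f (p.1 + p.2 • (y - x)) - f p.1 ≤ 0 := by
  have h1 : ∀ᶠ p in 𝓝 x, f (p + (y - x)) < f p := by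
    have hc : Continuous fun p => f (p + (y - x)) := hf.comp (by fun_prop)
    refine hc.continuousAt.eventually_lt hf.continuousAt ?_
    simpa using hxy
  have h2 : ∀ᶠ t : ℝ in 𝓝[>] 0, t < 1 :=
    nhdsWithin_le_nhds (eventually_lt_nhds one_pos)
  filter_upwards [tendsto_fst.eventually h1, tendsto_snd.eventually h2, eventually_snd_pos x]
    with p h1 h2 h3
  have h4 := hq (p.1 + (y - x)) p.1 p.2 ⟨h3.le, h2.le⟩
  rw [max_eq_right h1.le] at h4
  have h5 : p.2 • (p.1 + (y - x)) + (1 - p.2) • p.1 = p.1 + p.2 • (y - x) := by module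
  rw [h5] at h4
  linarith

/-- Upper bound for the Clarke derivative of a proximally regularized nonnegative combination. -/
theorem clarkeDeriv_sum_add_sq_le {n m : ℕ} {F : Fin m → EuclideanSpace ℝ (Fin n) → ℝ}
    (hlip : ∀ i, LocLipOn (F i)) {w : Fin m → ℝ} (hw : ∀ i, 0 ≤ w i) (c s : ℝ)
    (x a d : EuclideanSpace ℝ (Fin n))
    (hs : ∀ i, ∀ᶠ p : EuclideanSpace ℝ (Fin n) × ℝ in 𝓝 x ×ˢ 𝓝[>] (0 : ℝ),
      F i (p.1 + p.2 • d) - F i p.1 ≤ -s * p.2) :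
    clarkeDeriv (fun y => (∑ i, w i * F i y) + c * ‖y - a‖ ^ 2) x d ≤
      -s * (∑ i, w i) + 2 * c * ⟪x - a, d⟫ := by
  choose C hC using fun i => (hlip i).eventually_abs_quotient_le x d
  set q : EuclideanSpace ℝ (Fin n) × ℝ → ℝ :=
    fun p => c * (2 * ⟪p.1 - a, d⟫ + p.2 * ‖d‖ ^ 2) with hq
  have hqt : Tendsto q (𝓝 x ×ˢ 𝓝[>] (0 : ℝ)) (𝓝 (2 * c * ⟪x - a, d⟫)) := by
    have hc : Continuous q := by fun_prop
    have h := hc.tendsto (x, (0 : ℝ))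
    rw [nhds_prod_eq] at h
    have h0 : q (x, 0) = 2 * c * ⟪x - a, d⟫ := by simp only [hq]; ring
    rw [h0] at h
    exact h.mono_left (Filter.prod_mono le_rfl nhdsWithin_le_nhds)
  have hsplit : ∀ p : EuclideanSpace ℝ (Fin n) × ℝ, 0 < p.2 →
      (((∑ i, w i * F i (p.1 + p.2 • d)) + c * ‖p.1 + p.2 • d - a‖ ^ 2) -
        ((∑ i, w i * F i p.1) + c * ‖p.1 - a‖ ^ 2)) / p.2 =
      (∑ i, w i * ((F i (p.1 + p.2 • d) - F i p.1) / p.2)) + q p := by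
    intro p hp
    have h1 : ‖p.1 + p.2 • d - a‖ ^ 2 =
        ‖p.1 - a‖ ^ 2 + 2 * (p.2 * ⟪p.1 - a, d⟫) + p.2 ^ 2 * ‖d‖ ^ 2 := by
      rw [add_sub_right_comm, norm_add_sq_real, inner_smul_right, norm_smul, mul_pow,
        Real.norm_eq_abs, sq_abs]
    have h2 : ∑ i, w i * ((F i (p.1 + p.2 • d) - F i p.1) / p.2) =
        ((∑ i, w i * F i (p.1 + p.2 • d)) - ∑ i, w i * F i p.1) / p.2 := by
      rw [← Finset.sum_sub_distrib, Finset.sum_div]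
      exact Finset.sum_congr rfl fun i _ => by ring
    rw [h1, h2, hq]
    field_simp
    ring
  have hut : Tendsto (fun p => -s * (∑ i, w i) + q p) (𝓝 x ×ˢ 𝓝[>] (0 : ℝ))
      (𝓝 (-s * (∑ i, w i) + 2 * c * ⟪x - a, d⟫)) := hqt.const_add _
  rw [← hut.limsup_eq]
  refine limsup_le_limsup ?_ ?_ hut.isBoundedUnder_le
  · filter_upwards [eventually_all.2 hs, eventually_snd_pos x] with p h1 h2
    rw [hsplit p h2, Finset.mul_sum]
    refine add_le_add_left (Finset.sum_le_sum fun i _ => ?_) _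
    have h3 : (F i (p.1 + p.2 • d) - F i p.1) / p.2 ≤ -s := (div_le_iff₀ h2).2 (h1 i)
    linarith [mul_le_mul_of_nonneg_left h3 (hw i)]
  · refine IsBoundedUnder.isCoboundedUnder_le (isBoundedUnder_of_eventually_ge
      (a := (∑ i, w i * (-C i)) + (2 * c * ⟪x - a, d⟫ - 1)) ?_)
    filter_upwards [eventually_all.2 hC, eventually_snd_pos x,
      hqt.eventually (lt_mem_nhds (sub_one_lt _))] with p h1 h2 h3
    rw [hsplit p h2]
    exact add_le_add (Finset.sum_le_sum fun i _ =>
      mul_le_mul_of_nonneg_left (abs_le.1 (h1 i)).1 (hw i)) h3.le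

theorem convex_setOf_forall_le {n m : ℕ} {F : Fin m → EuclideanSpace ℝ (Fin n) → ℝ}
    (hquasi : ∀ i, QuasiconvexFun (F i)) (r : Fin m → ℝ) :
    Convex ℝ {y : EuclideanSpace ℝ (Fin n) | ∀ i, F i y ≤ r i} := by
  intro u hu v hv a b ha hb hab i
  obtain rfl : b = 1 - a := by linarith
  exact (hquasi i u v a ⟨ha, by linarith⟩).trans (max_le (hu i) (hv i))

/-- A sequence that moves towards a fixed point `y` at an obtuse angle is Fejér monotone. -/
theorem norm_sub_le_of_inner_nonneg {E : Type*} [NormedAddCommGroup E] [InnerProductSpace ℝ E]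
    {a b y : E} (h : 0 ≤ ⟪b - a, y - b⟫) : ‖b - y‖ ≤ ‖a - y‖ := by
  have h1 : a - y = (b - y) - (b - a) := by abel
  have h2 : ‖a - y‖ ^ 2 = ‖b - y‖ ^ 2 - 2 * ⟪b - y, b - a⟫ + ‖b - a‖ ^ 2 := by
    rw [h1, norm_sub_sq_real]
  have h3 : ⟪b - y, b - a⟫ = -⟪b - a, y - b⟫ := by
    rw [real_inner_comm, ← inner_neg_right, neg_sub]
  refine le_of_sq_le_sq ?_ (norm_nonneg _)
  nlinarith [sq_nonneg ‖b - a‖]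

/-- A sequence with decreasing values that is Fejér monotone with respect to the set of points below
all of its values converges, provided that set is nonempty. -/
theorem exists_tendsto_of_fejer {n m : ℕ} {F : Fin m → EuclideanSpace ℝ (Fin n) → ℝ}
    (hF : ∀ i, Continuous (F i)) {x : ℕ → EuclideanSpace ℝ (Fin n)}
    (hanti : ∀ i, Antitone fun k => F i (x k)) {b : EuclideanSpace ℝ (Fin n)}
    (hb : ∀ k i, F i b ≤ F i (x k))
    (hfejer : ∀ y, (∀ k i, F i y ≤ F i (x k)) → Antitone fun k => ‖x k - y‖) :
    ∃ xbar, Tendsto x atTop (𝓝 xbar) := by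
  have hmem : ∀ k, x k ∈ closedBall b ‖x 0 - b‖ := fun k => by
    rw [mem_closedBall, dist_eq_norm]
    exact hfejer b hb (Nat.zero_le k)
  obtain ⟨xbar, -, φ, hφ, hlim⟩ := tendsto_subseq_of_bounded isBounded_closedBall hmem
  refine ⟨xbar, ?_⟩
  have hbar : ∀ k i, F i xbar ≤ F i (x k) := fun k i => by
    refine le_of_tendsto (((hF i).tendsto xbar).comp hlim) ?_
    filter_upwards [eventually_ge_atTop k] with j hj
    exact hanti i (hj.trans (hφ.id_le j))
  rw [tendsto_iff_norm_sub_tendsto_zero] at hlim ⊢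
  exact (tendsto_iff_tendsto_subseq_of_antitone (hfejer xbar hbar) hφ.tendsto_atTop).2 hlim

theorem one_le_sum_of_norm_eq_one {m : ℕ} {z : EuclideanSpace ℝ (Fin m)} (hz : ‖z‖ = 1)
    (h0 : ∀ i, 0 ≤ z i) : 1 ≤ ∑ i, z i := by
  have h1 : ∑ i, z i ^ 2 = 1 := by rw [← EuclideanSpace.real_norm_sq_eq, hz, one_pow]
  rw [← h1]
  refine Finset.sum_le_sum fun i _ => ?_
  have h2 : z i ≤ 1 := by
    have := PiLp.norm_apply_le z i
    rwa [hz, Real.norm_of_nonneg (h0 i)] at this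
  nlinarith [h0 i]

/-- Global convergence of the SPPM algorithm: the sequence converges to a
Pareto-Clarke critical point of `min {F(x) : x ∈ ℝⁿ}`. -/
theorem sppm_global_convergence {n m : ℕ} (F : Fin m → EuclideanSpace ℝ (Fin n) → ℝ)
    (hlip : ∀ i, LocLipOn (F i)) (hquasi : ∀ i, QuasiconvexFun (F i))
    (hpos : ∀ x i, 0 < F i x)
    (x : ℕ → EuclideanSpace ℝ (Fin n)) (α : ℕ → ℝ) (e z : ℕ → EuclideanSpace ℝ (Fin m))
    (hsppm : SPPMSeq F x α e z)
    (hH3 : H3 F (x 0))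
    (αbar : ℝ) (hαbar : 0 < αbar) (hα : ∀ k, 0 < α k ∧ α k < αbar)
    (hne : ∀ k, ‖e k‖ = 1) (hnz : ∀ k, ‖z k‖ = 1)
    (hint : ∀ k,
      (interior {y : EuclideanSpace ℝ (Fin n) | ∀ i, F i y ≤ F i (x (k + 1))}).Nonempty ∧
      ∀ y ∈ interior {y : EuclideanSpace ℝ (Fin n) | ∀ i, F i y ≤ F i (x (k + 1))},
        ∀ i, F i y < F i (x (k + 1))) :
    ∃ xbar : EuclideanSpace ℝ (Fin n), Tendsto x atTop (𝓝 xbar) ∧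
      ∀ d : EuclideanSpace ℝ (Fin n), ∃ i, 0 ≤ clarkeDeriv (F i) xbar d := by
  obtain ⟨-, hepos, hz0, hzne, hstep⟩ := hsppm
  have hcont : ∀ i, Continuous (F i) := fun i => (hlip i).continuous
  have hanti : ∀ i, Antitone fun k => F i (x k) := fun i =>
    antitone_nat_of_succ_le fun k => (hstep k).1 i
  obtain ⟨b, hb⟩ := hH3 x rfl fun k => (hstep k).1
  set c : ℕ → ℝ := fun k => α k * ∑ i, e k i * z k i with hc
  have hcpos : ∀ k, 0 < c k := fun k => by
    have hle := one_le_sum_of_norm_eq_one (hnz k) (hz0 k)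
    refine mul_pos (hα k).1 (lt_of_le_of_ne
      (Finset.sum_nonneg fun i _ => mul_nonneg (hepos k i).le (hz0 k i)) fun h => ?_)
    rw [eq_comm, Finset.sum_eq_zero_iff_of_nonneg
      fun i _ => mul_nonneg (hepos k i).le (hz0 k i)] at h
    refine hzne k (PiLp.ext fun i => ?_)
    exact (mul_eq_zero.1 (h i (Finset.mem_univ i))).resolve_left (hepos k i).ne'
  have hcle : ∀ k, c k ≤ αbar := fun k => by
    have h1 : ∑ i, e k i * z k i ≤ 1 := by
      have := real_inner_le_norm (z k) (e k)
      rw [hne, hnz, mul_one] at this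
      simpa [PiLp.inner_apply] using this
    calc c k ≤ α k * 1 := mul_le_mul_of_nonneg_left h1 (hα k).1.le
      _ ≤ αbar := by linarith [(hα k).2]
  have hkey : ∀ k s d, (∀ i, ∀ᶠ p : EuclideanSpace ℝ (Fin n) × ℝ in
        𝓝 (x (k + 1)) ×ˢ 𝓝[>] (0 : ℝ), F i (p.1 + p.2 • d) - F i p.1 ≤ -s * p.2) →
      (∃ t > (0 : ℝ), ∀ i, F i (x (k + 1) + t • d) ≤ F i (x (k + 1))) →
      s * ∑ i, z k i ≤ c k * ⟪x (k + 1) - x k, d⟫ := by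
    rintro k s d hs ⟨t, ht, htd⟩
    obtain ⟨g, hg, v, hv, hgv⟩ := Set.mem_add.1 (hstep k).2
    have h1 := (hg d).trans (clarkeDeriv_sum_add_sq_le hlip (hz0 k) _ s _ _ d hs)
    have h2 := hv (x (k + 1) + t • d) fun i => (htd i).trans ((hstep k).1 i)
    rw [add_sub_cancel_left, inner_smul_right] at h2
    have h3 : ⟪v, d⟫ ≤ 0 := nonpos_of_mul_nonpos_right h2 ht
    have h4 : ⟪g, d⟫ + ⟪v, d⟫ = 0 := by rw [← inner_add_left, hgv, inner_zero_left]
    have h5 : 2 * (α k / 2 * ∑ i, e k i * z k i) = c k := by rw [hc]; ring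
    rw [h5] at h1
    linarith
  have hangle : ∀ k y, (∀ i, F i y ≤ F i (x (k + 1))) →
      0 ≤ ⟪x (k + 1) - x k, y - x (k + 1)⟫ := by
    intro k y hy
    set S := {y : EuclideanSpace ℝ (Fin n) | ∀ i, F i y ≤ F i (x (k + 1))} with hS
    have hconv : Convex ℝ S := convex_setOf_forall_le hquasi _
    have hycl : y ∈ closure (interior S) := by
      rw [hconv.closure_interior_eq_closure_of_nonempty_interior (hint k).1]
      exact subset_closure hy
    have hclosed : IsClosed {y | 0 ≤ ⟪x (k + 1) - x k, y - x (k + 1)⟫} :=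
      isClosed_le continuous_const (by fun_prop)
    refine closure_minimal (fun u hu => ?_) hclosed hycl
    have h := hkey k 0 (u - x (k + 1)) (fun i => by
      simpa using (hquasi i).eventually_sub_nonpos (hcont i) ((hint k).2 u hu i))
      ⟨1, one_pos, fun i => by simpa using ((hint k).2 u hu i).le⟩
    rw [zero_mul] at h
    exact nonneg_of_mul_nonneg_right h (hcpos k)
  obtain ⟨xbar, hx⟩ := exists_tendsto_of_fejer hcont hanti hb fun y hy =>
    antitone_nat_of_succ_le fun k => norm_sub_le_of_inner_nonneg (hangle k y (hy (k + 1)))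
  refine ⟨xbar, hx, fun d => ?_⟩
  by_contra! hd
  have hsmall : ∀ᶠ s : ℝ in 𝓝[>] 0, ∀ i, clarkeDeriv (F i) xbar d < -s :=
    eventually_all.2 fun i => nhdsWithin_le_nhds <| by
      filter_upwards [eventually_lt_nhds (neg_pos.2 (hd i))] with s hs using by linarith
  obtain ⟨s, hs, hspos⟩ := (hsmall.and eventually_mem_nhdsWithin).exists
  have hspos : 0 < s := hspos
  have hdesc := eventually_all.2 fun i => (hlip i).eventually_sub_le (hs i)
  obtain ⟨P, hP, Q, hQ, hPQ⟩ := eventually_prod_iff.1 hdesc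
  have hx1 : Tendsto (fun k => x (k + 1)) atTop (𝓝 xbar) := (tendsto_add_atTop_iff_nat 1).2 hx
  have hbound : ∀ᶠ k in atTop, s ≤ αbar * (‖x (k + 1) - x k‖ * ‖d‖) := by
    filter_upwards [hx1.eventually (eventually_eventually_nhds.2 hP)] with k hk
    obtain ⟨t, htQ, ht⟩ := (hQ.and eventually_mem_nhdsWithin).exists
    have ht : 0 < t := ht
    have h := hkey k s d
      (fun i => (hk.prod_mk hQ).mono fun p hp => hPQ hp.1 hp.2 i)
      ⟨t, ht, fun i => by
        have := hPQ hk.self_of_nhds htQ i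
        dsimp only at this
        nlinarith [mul_pos hspos ht]⟩
    calc s ≤ s * ∑ i, z k i :=
          le_mul_of_one_le_right hspos.le (one_le_sum_of_norm_eq_one (hnz k) (hz0 k))
      _ ≤ c k * ⟪x (k + 1) - x k, d⟫ := h
      _ ≤ c k * (‖x (k + 1) - x k‖ * ‖d‖) :=
          mul_le_mul_of_nonneg_left (real_inner_le_norm _ _) (hcpos k).le
      _ ≤ αbar * (‖x (k + 1) - x k‖ * ‖d‖) :=
          mul_le_mul_of_nonneg_right (hcle k) (by positivity)
  have hlim : Tendsto (fun k => αbar * (‖x (k + 1) - x k‖ * ‖d‖)) atTop (𝓝 0) := by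
    simpa using (((hx1.sub hx).norm).mul_const ‖d‖).const_mul αbar
  exact hspos.not_ge (ge_of_tendsto hlim hbound)
end
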